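/- arXiv:1302.3741 — 3 statements merged into one kernel-verified Lean document; each statement's English description precedes it below -/
import Mathlib

section
/- Let P(x, y) be an n-vector of monotone polynomials of degree ≤ 2 in variables x ∈ ℝ^n and y ∈ ℝ^m. Let 0 < y₁ ≤ 1 and 0 ≤ y₂ ≤ y₁ be m-vectors, and set P₁(x) = P(x, y₁), P₂(x) = P(x, y₂). Then for every x with 0 ≤ x ≤ 1, ‖P₁(x) − P₂(x)‖_∞ ≤ 2·‖P(1, 1)‖_∞ · ‖y₁ − y₂‖_∞. -/
open Matrix MvPolynomial

lemma aux_mul (a b c d e f : ℝ) (ha : |a| ≤ 1) (hd : |d| ≤ 1)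
    (h1 : |a - b| ≤ e) (h2 : |c - d| ≤ f) : |a * c - b * d| ≤ e + f := by
  have : a * c - b * d = a * (c - d) + (a - b) * d := by ring
  rw [this]
  refine (abs_add_le _ _).trans ?_
  rw [abs_mul, abs_mul]
  nlinarith [abs_nonneg a, abs_nonneg d, abs_nonneg (a - b), abs_nonneg (c - d)]

lemma aux_pow (a b δ : ℝ) (ha : |a| ≤ 1) (hb : |b| ≤ 1) (h : |a - b| ≤ δ) (k : ℕ) :
    |a ^ k - b ^ k| ≤ k * δ := by
  induction k with
  | zero => simp
  | succ k ih =>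
    have := aux_mul (a ^ k) (b ^ k) a b _ _
      (by rw [abs_pow]; exact pow_le_one₀ (abs_nonneg _) ha) hb ih h
    rw [pow_succ, pow_succ]
    push_cast
    linarith

lemma aux_prod_le {σ : Type*} (u : σ → ℝ) (hu : ∀ s, |u s| ≤ 1) (d : σ → ℕ) (F : Finset σ) :
    |∏ s ∈ F, u s ^ d s| ≤ 1 := by
  rw [Finset.abs_prod]
  refine Finset.prod_le_one (fun i _ => abs_nonneg _) (fun i _ => ?_)
  rw [abs_pow]; exact pow_le_one₀ (abs_nonneg _) (hu i)

lemma aux_prod {σ : Type*} (u v : σ → ℝ) (hu : ∀ s, |u s| ≤ 1) (hv : ∀ s, |v s| ≤ 1)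
    (δ : ℝ) (h : ∀ s, |u s - v s| ≤ δ) (d : σ → ℕ) (F : Finset σ) :
    |∏ s ∈ F, u s ^ d s - ∏ s ∈ F, v s ^ d s| ≤ ((∑ s ∈ F, d s : ℕ) : ℝ) * δ := by
  classical
  induction F using Finset.induction_on with
  | empty => simp
  | insert a F ha ih =>
    rw [Finset.prod_insert ha, Finset.prod_insert ha, Finset.sum_insert ha]
    have := aux_mul (u a ^ d a) (v a ^ d a) _ _ _ _
      (by rw [abs_pow]; exact pow_le_one₀ (abs_nonneg _) (hu a)) (aux_prod_le v hv d F)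
      (aux_pow _ _ δ (hu a) (hv a) (h a) (d a)) ih
    push_cast at this ⊢
    linarith

lemma aux_eval {σ : Type*} (p : MvPolynomial σ ℝ) (hpos : ∀ mo, 0 ≤ p.coeff mo)
    (hdeg : p.totalDegree ≤ 2) (u v : σ → ℝ) (hu : ∀ s, |u s| ≤ 1) (hv : ∀ s, |v s| ≤ 1)
    (δ : ℝ) (hδ : 0 ≤ δ) (h : ∀ s, |u s - v s| ≤ δ) :
    |MvPolynomial.eval u p - MvPolynomial.eval v p| ≤
      2 * MvPolynomial.eval (fun _ => (1 : ℝ)) p * δ := by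
  rw [MvPolynomial.eval_eq, MvPolynomial.eval_eq, MvPolynomial.eval_eq, ← Finset.sum_sub_distrib,
    Finset.mul_sum, Finset.sum_mul]
  refine (Finset.abs_sum_le_sum_abs _ _).trans (Finset.sum_le_sum fun d hd => ?_)
  rw [← mul_sub, abs_mul, abs_of_nonneg (hpos d)]
  have h1 := aux_prod u v hu hv δ h d d.support
  have h2 : ∑ s ∈ d.support, d s ≤ 2 := (MvPolynomial.le_totalDegree hd).trans hdeg
  have h3 : ((∑ s ∈ d.support, d s : ℕ) : ℝ) ≤ 2 := by exact_mod_cast h2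
  have h4 := mul_le_mul_of_nonneg_left (h1.trans (mul_le_mul_of_nonneg_right h3 hδ)) (hpos d)
  simp only [one_pow, Finset.prod_const_one, mul_one]
  linarith

theorem stmt10 {n m : ℕ} (hn : 0 < n) (hm : 0 < m)
    (P : Fin n → MvPolynomial (Fin n ⊕ Fin m) ℝ)
    (hpos : ∀ i mo, 0 ≤ (P i).coeff mo)
    (hdeg : ∀ i, (P i).totalDegree ≤ 2)
    (y₁ y₂ : Fin m → ℝ) (hy₁pos : ∀ j, 0 < y₁ j) (hy₁le : y₁ ≤ 1)
    (hy₂0 : 0 ≤ y₂) (hy₂₁ : y₂ ≤ y₁)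
    (x : Fin n → ℝ) (hx0 : 0 ≤ x) (hx1 : x ≤ 1) :
    (⨆ i, |MvPolynomial.eval (Sum.elim x y₁) (P i) -
            MvPolynomial.eval (Sum.elim x y₂) (P i)|) ≤
      2 * (⨆ i, |MvPolynomial.eval (Sum.elim (1 : Fin n → ℝ) (1 : Fin m → ℝ)) (P i)|) *
        (⨆ j, |y₁ j - y₂ j|) := by
  haveI : Nonempty (Fin n) := ⟨⟨0, hn⟩⟩
  have hδ : 0 ≤ ⨆ j, |y₁ j - y₂ j| := Real.iSup_nonneg fun j => abs_nonneg _
  have hone : Sum.elim (1 : Fin n → ℝ) (1 : Fin m → ℝ) = fun _ => (1 : ℝ) := by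
    funext s; cases s <;> rfl
  refine ciSup_le fun i => ?_
  have key := aux_eval (P i) (hpos i) (hdeg i) (Sum.elim x y₁) (Sum.elim x y₂)
    (by
      rintro (s | s)
      · exact abs_le.2 ⟨by have := hx0 s; simp at this ⊢; linarith, hx1 s⟩
      · exact abs_le.2 ⟨by have := hy₁pos s; simp at this ⊢; linarith, hy₁le s⟩)
    (by
      rintro (s | s)
      · exact abs_le.2 ⟨by have := hx0 s; simp at this ⊢; linarith, hx1 s⟩
      · exact abs_le.2 ⟨by have := hy₂0 s; simp at this ⊢; linarith, (hy₂₁ s).trans (hy₁le s)⟩)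
    _ hδ
    (by
      rintro (s | s)
      · simpa using hδ
      · exact le_ciSup (f := fun j => |y₁ j - y₂ j|) (Set.finite_range _).bddAbove s)
  refine key.trans (mul_le_mul_of_nonneg_right ?_ hδ)
  rw [hone]
  refine mul_le_mul_of_nonneg_left ((le_abs_self _).trans ?_) (by norm_num)
  exact le_ciSup (f := fun i => |MvPolynomial.eval (fun _ => (1 : ℝ)) (P i)|)
    (Set.finite_range _).bddAbove i
end

section
/- Let x = P(x) be a quadratic MPS with least fixed point q* > 0. Then q* is an isolated solution of the system of equations x = P(x) in the Euclidean topology of ℝ^n: there exists ε > 0 such that any q with ‖q − q*‖_∞ ≤ ε and P(q) = q satisfies q = q*. -/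
open Matrix MvPolynomial

/-- Evaluation of a vector of multivariate polynomials. -/
noncomputable def evalVec {n : ℕ} (P : Fin n → MvPolynomial (Fin n) ℝ) (x : Fin n → ℝ) :
    Fin n → ℝ := fun i => MvPolynomial.eval x (P i)

open Filter Topology

/-- Explicit nonnegative quadratic form of a function. -/
def IsQF {n : ℕ} (f : (Fin n → ℝ) → ℝ) : Prop :=
  ∃ (c : ℝ) (b : Fin n → ℝ) (a : Fin n → Fin n → ℝ), 0 ≤ c ∧ (∀ j, 0 ≤ b j) ∧
    (∀ j k, 0 ≤ a j k) ∧
    ∀ x, f x = c + ∑ j, b j * x j + ∑ j, ∑ k, a j k * (x j * x k)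

lemma IsQF.zero {n : ℕ} : IsQF (fun _ : Fin n → ℝ => (0 : ℝ)) :=
  ⟨0, fun _ => 0, fun _ _ => 0, le_rfl, fun _ => le_rfl, fun _ _ => le_rfl, by simp⟩

lemma IsQF.add {n : ℕ} {f g : (Fin n → ℝ) → ℝ} (hf : IsQF f) (hg : IsQF g) :
    IsQF (fun x => f x + g x) := by
  obtain ⟨c, b, a, hc, hb, ha, h⟩ := hf
  obtain ⟨c', b', a', hc', hb', ha', h'⟩ := hg
  refine ⟨c + c', fun j => b j + b' j, fun j k => a j k + a' j k, by positivity,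
    fun j => add_nonneg (hb j) (hb' j), fun j k => add_nonneg (ha j k) (ha' j k), fun x => ?_⟩
  simp only [h, h', add_mul, Finset.sum_add_distrib]
  ring

lemma IsQF.sum {n : ℕ} {ι : Type*} (s : Finset ι) (f : ι → (Fin n → ℝ) → ℝ)
    (hf : ∀ i ∈ s, IsQF (f i)) : IsQF (fun x => ∑ i ∈ s, f i x) := by
  classical
  induction s using Finset.induction_on with
  | empty => simpa using IsQF.zero
  | insert i s hi ih =>
    simp only [Finset.sum_insert hi]
    exact (hf i (by simp)).add (ih fun j hj => hf j (by simp [hj]))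

lemma isQF_monomial {n : ℕ} (m : Fin n →₀ ℕ) (hm : (m.sum fun _ e => e) ≤ 2) (t : ℝ)
    (ht : 0 ≤ t) : IsQF (fun x : Fin n → ℝ => t * m.prod fun i e => x i ^ e) := by
  classical
  by_cases h0 : m = 0
  · subst h0
    exact ⟨t, fun _ => 0, fun _ _ => 0, ht, fun _ => le_rfl, fun _ _ => le_rfl, by simp⟩
  obtain ⟨j, hj⟩ : ∃ j, m j ≠ 0 := by
    by_contra! h
    exact h0 (Finsupp.ext h)
  obtain ⟨m', rfl⟩ : ∃ m', m = m' + Finsupp.single j 1 :=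
    ⟨m - Finsupp.single j 1, (tsub_add_cancel_of_le (by
      rw [Finsupp.single_le_iff]; omega)).symm⟩
  have e1 : ∀ x : Fin n → ℝ, ((m' + Finsupp.single j 1).prod fun i e => x i ^ e)
      = (m'.prod fun i e => x i ^ e) * x j := by
    intro x
    rw [Finsupp.prod_add_index' (by simp) (by intros; rw [pow_add])]
    simp
  rw [Finsupp.sum_add_index' (by simp) (by simp)] at hm
  simp only [Finsupp.sum_single_index] at hm
  simp only [e1]
  by_cases h1 : m' = 0
  · subst h1
    refine ⟨0, fun i => if i = j then t else 0, fun _ _ => 0, le_rfl, fun i => ?_,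
      fun _ _ => le_rfl, by simp⟩
    dsimp only; split_ifs <;> simp [ht]
  obtain ⟨k, hk⟩ : ∃ k, m' k ≠ 0 := by
    by_contra! h
    exact h1 (Finsupp.ext h)
  obtain ⟨m'', rfl⟩ : ∃ m'', m' = m'' + Finsupp.single k 1 :=
    ⟨m' - Finsupp.single k 1, (tsub_add_cancel_of_le (by
      rw [Finsupp.single_le_iff]; omega)).symm⟩
  rw [Finsupp.sum_add_index' (by simp) (by simp)] at hm
  simp only [Finsupp.sum_single_index] at hm
  have h2 : m'' = 0 := by
    ext l
    by_contra h
    have hl : l ∈ m''.support := by simpa using h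
    have := Finset.single_le_sum (f := fun i => m'' i) (fun i _ => Nat.zero_le _) hl
    have h3 : (m''.sum fun _ e => e) = 0 := by omega
    simp only [Finsupp.sum] at h3
    simp only [Finsupp.coe_zero, Pi.zero_apply] at h
    omega
  subst h2
  refine ⟨0, fun _ => 0, fun i l => if i = k then (if l = j then t else 0) else 0, le_rfl,
    fun _ => le_rfl, fun i l => ?_, ?_⟩
  · dsimp only; split_ifs <;> simp [ht]
  · intro x
    simp [Finset.sum_ite_eq, ite_mul]

lemma isQF_eval {n : ℕ} (p : MvPolynomial (Fin n) ℝ) (hd : p.totalDegree ≤ 2)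
    (hp : ∀ m, 0 ≤ p.coeff m) : IsQF (fun x => MvPolynomial.eval x p) := by
  have : (fun x => MvPolynomial.eval x p) =
      fun x => ∑ m ∈ p.support, p.coeff m * m.prod fun i e => x i ^ e := by
    funext x
    rw [MvPolynomial.eval_eq]
    refine Finset.sum_congr rfl fun m _ => ?_
    rfl
  rw [this]
  exact IsQF.sum _ _ fun m hm =>
    isQF_monomial m ((MvPolynomial.le_totalDegree hm).trans hd) _ (hp m)

/-- Knaster–Tarski on the nonnegative orthant. -/
lemma exists_fix_le {n : ℕ} (f : (Fin n → ℝ) → Fin n → ℝ)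
    (h0 : ∀ x, 0 ≤ x → 0 ≤ f x) (hm : ∀ x y, 0 ≤ x → x ≤ y → f x ≤ f y)
    (y : Fin n → ℝ) (hy : 0 ≤ y) (hfy : f y ≤ y) : ∃ z, 0 ≤ z ∧ f z = z ∧ z ≤ y := by
  let S := {x : Fin n → ℝ // 0 ≤ x ∧ f x ≤ x}
  haveI : Nonempty S := ⟨⟨y, hy, hfy⟩⟩
  let z : Fin n → ℝ := fun i => ⨅ x : S, x.1 i
  have hz0 : 0 ≤ z := fun i => le_ciInf fun x => x.2.1 i
  have hzle : ∀ x : S, z ≤ x.1 := fun x i =>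
    ciInf_le (f := fun x : S => x.1 i) ⟨0, by rintro _ ⟨x, rfl⟩; exact x.2.1 i⟩ x
  have h1 : f z ≤ z := fun i => le_ciInf fun x => (hm z x.1 hz0 (hzle x) i).trans (x.2.2 i)
  have h2 : z ≤ f z := hzle ⟨f z, h0 z hz0, hm _ _ (h0 z hz0) h1⟩
  exact ⟨z, hz0, le_antisymm h1 h2, hzle ⟨y, hy, hfy⟩⟩

theorem core {n : ℕ} (f : (Fin n → ℝ) → Fin n → ℝ)
    (c : Fin n → ℝ) (b : Fin n → Fin n → ℝ) (a : Fin n → Fin n → Fin n → ℝ)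
    (hc : ∀ i, 0 ≤ c i) (hb : ∀ i j, 0 ≤ b i j) (ha : ∀ i j k, 0 ≤ a i j k)
    (hf : ∀ x i, f x i = c i + ∑ j, b i j * x j + ∑ j, ∑ k, a i j k * (x j * x k))
    (q : Fin n → ℝ) (hq : ∀ i, 0 < q i) (hfix : f q = q)
    (hleast : ∀ r : Fin n → ℝ, 0 ≤ r → f r = r → q ≤ r) :
    ∃ ε > (0 : ℝ), ∀ r : Fin n → ℝ, (∀ i, |r i - q i| ≤ ε) → f r = r → r = q := by
  classical
  obtain ⟨δ, hδ, hδq⟩ : ∃ δ > (0 : ℝ), ∀ i, δ ≤ q i := by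
    rcases isEmpty_or_nonempty (Fin n) with h | h
    · exact ⟨1, one_pos, fun i => h.elim i⟩
    · obtain ⟨i, hi⟩ := Finite.exists_min q
      exact ⟨q i, hq i, hi⟩
  have h0 : ∀ x, 0 ≤ x → 0 ≤ f x := by
    intro x hx i
    rw [hf]
    have hx' : ∀ j, 0 ≤ x j := hx
    have := hc i
    have h1 : 0 ≤ ∑ j, b i j * x j := Finset.sum_nonneg fun j _ => mul_nonneg (hb i j) (hx' j)
    have h2 : 0 ≤ ∑ j, ∑ k, a i j k * (x j * x k) := Finset.sum_nonneg fun j _ =>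
      Finset.sum_nonneg fun k _ => mul_nonneg (ha i j k) (mul_nonneg (hx' j) (hx' k))
    show (0 : ℝ) ≤ _
    linarith
  have hm : ∀ x y, 0 ≤ x → x ≤ y → f x ≤ f y := by
    intro x y hx hxy i
    rw [hf, hf]
    have hx' : ∀ j, 0 ≤ x j := hx
    have h1 : ∑ j, b i j * x j ≤ ∑ j, b i j * y j :=
      Finset.sum_le_sum fun j _ => mul_le_mul_of_nonneg_left (hxy j) (hb i j)
    have h2 : ∑ j, ∑ k, a i j k * (x j * x k) ≤ ∑ j, ∑ k, a i j k * (y j * y k) :=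
      Finset.sum_le_sum fun j _ => Finset.sum_le_sum fun k _ =>
        mul_le_mul_of_nonneg_left (mul_le_mul (hxy j) (hxy k) (hx' k)
          ((hx' j).trans (hxy j))) (ha i j k)
    linarith
  -- the Jacobian and the quadratic part
  let B : Fin n → Fin n → ℝ := fun i j => b i j + ∑ k, (a i j k + a i k j) * q k
  let Q : (Fin n → ℝ) → Fin n → ℝ := fun d i => ∑ j, ∑ k, a i j k * (d j * d k)
  have hB : ∀ i j, 0 ≤ B i j := fun i j => add_nonneg (hb i j)
    (Finset.sum_nonneg fun k _ => mul_nonneg (add_nonneg (ha _ _ _) (ha _ _ _)) (hq k).le)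
  have hexp : ∀ d t i, f (fun j => q j + t * d j) i
      = q i + t * ∑ j, B i j * d j + t ^ 2 * Q d i := by
    intro d t i
    have hqi : q i = f q i := by rw [hfix]
    rw [hqi, hf, hf]
    have e1 : ∑ j, B i j * d j = ∑ j, b i j * d j + (∑ j, ∑ k, a i j k * (d j * q k)
        + ∑ j, ∑ k, a i j k * (q j * d k)) := by
      rw [Finset.sum_comm (f := fun j k => a i j k * (q j * d k))]
      simp only [← Finset.sum_add_distrib]
      refine Finset.sum_congr rfl fun j _ => ?_
      simp only [B, add_mul, Finset.sum_mul, Finset.sum_add_distrib]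
      simp only [← add_assoc]
      congr 1
      · congr 1
        exact Finset.sum_congr rfl fun k _ => by ring
      · exact Finset.sum_congr rfl fun k _ => by ring
    have e2 : ∑ j, ∑ k, a i j k * ((q j + t * d j) * (q k + t * d k)) =
        ∑ j, ∑ k, a i j k * (q j * q k) + t * (∑ j, ∑ k, a i j k * (d j * q k)
        + ∑ j, ∑ k, a i j k * (q j * d k)) + t ^ 2 * Q d i := by
      simp only [Q, ← Finset.sum_add_distrib, Finset.mul_sum]
      refine Finset.sum_congr rfl fun j _ => Finset.sum_congr rfl fun k _ => by ring
    have e3 : ∑ j, b i j * (q j + t * d j) = ∑ j, b i j * q j + t * ∑ j, b i j * d j := by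
      simp only [← Finset.sum_add_distrib, Finset.mul_sum]
      refine Finset.sum_congr rfl fun j _ => by ring
    rw [e1, e2, e3]
    ring
  have hQ0 : ∀ d, (∀ i, 0 ≤ d i) → ∀ i, 0 ≤ Q d i := fun d hd i => Finset.sum_nonneg fun j _ =>
      Finset.sum_nonneg fun k _ => mul_nonneg (ha i j k) (mul_nonneg (hd j) (hd k))
  have hBz : ∀ i j, B i j = 0 → b i j = 0 ∧ ∀ k, a i j k = 0 ∧ a i k j = 0 := by
    intro i j h
    have h1 : ∀ k, 0 ≤ (a i j k + a i k j) * q k := fun k =>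
      mul_nonneg (add_nonneg (ha _ _ _) (ha _ _ _)) (hq k).le
    have h2 := (add_eq_zero_iff_of_nonneg (hb i j) (Finset.sum_nonneg fun k _ => h1 k)).1 h
    refine ⟨h2.1, fun k => ?_⟩
    have h3 := (Finset.sum_eq_zero_iff_of_nonneg (fun k _ => h1 k)).1 h2.2 k (Finset.mem_univ k)
    have h4 := (mul_eq_zero.1 h3).resolve_right (hq k).ne'
    exact (add_eq_zero_iff_of_nonneg (ha _ _ _) (ha _ _ _)).1 h4
  by_contra! hcon
  have hex : ∀ k : ℕ, ∃ d : Fin n → ℝ, d ≠ 0 ∧ (∀ i, 0 ≤ d i) ∧ (∀ i, d i ≤ q i) ∧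
      ‖d‖ ≤ 1 / (k + 1) ∧ ∀ i, d i = ∑ j, B i j * d j + Q d i := by
    intro k
    have hk : (0 : ℝ) < 1 / (k + 1) := by positivity
    obtain ⟨r, hr, hfr, hne⟩ := hcon (min δ (1 / (k + 1))) (lt_min hδ hk)
    have hr1 : ∀ i, |r i - q i| ≤ δ := fun i => (hr i).trans (min_le_left _ _)
    have hr2 : ∀ i, |r i - q i| ≤ 1 / (k + 1) := fun i => (hr i).trans (min_le_right _ _)
    have hr0 : 0 ≤ r := fun i => by
      have := (abs_le.1 (hr1 i)).1
      have := hδq i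
      show (0 : ℝ) ≤ r i
      linarith
    have hqr := hleast r hr0 hfr
    refine ⟨r - q, sub_ne_zero.2 hne, fun i => sub_nonneg.2 (hqr i), fun i => ?_, ?_, fun i => ?_⟩
    · exact ((abs_le.1 (hr1 i)).2).trans (hδq i)
    · exact (pi_norm_le_iff_of_nonneg hk.le).2 hr2
    · have h := hexp (r - q) 1 i
      have e : (fun j => q j + 1 * (r - q) j) = r := by funext j; simp
      rw [e, hfr] at h
      simp only [Pi.sub_apply] at h ⊢
      linarith
  choose d hd0 hdn hdq hdk hde using hex
  have hs : ∀ k, 0 < ‖d k‖ := fun k => norm_pos_iff.2 (hd0 k)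
  let u : ℕ → Fin n → ℝ := fun k => ‖d k‖⁻¹ • d k
  have hu : ∀ k, u k ∈ Metric.sphere (0 : Fin n → ℝ) 1 := by
    intro k
    simp [u, norm_smul, (hs k).ne']
  obtain ⟨v, hv, φ, hφ, hlim⟩ := (isCompact_sphere (0 : Fin n → ℝ) 1).tendsto_subseq hu
  have hlimi : ∀ i, Tendsto (fun k => u (φ k) i) atTop (𝓝 (v i)) := tendsto_pi_nhds.1 hlim
  have hv0 : ∀ i, 0 ≤ v i := fun i => ge_of_tendsto' (hlimi i) fun k =>
    mul_nonneg (inv_nonneg.2 (norm_nonneg _)) (hdn _ i)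
  have hvne : ∃ i, 0 < v i := by
    by_contra! h
    have : v = 0 := funext fun i => le_antisymm (h i) (hv0 i)
    simp [this] at hv
  have hue : ∀ k i, u k i = ∑ j, B i j * u k j + ‖d k‖ * Q (u k) i := by
    intro k i
    have h1 : u k i = ‖d k‖⁻¹ * (∑ j, B i j * d k j + Q (d k) i) := by rw [← hde]; rfl
    have h2 : Q (u k) i = ‖d k‖⁻¹ ^ 2 * Q (d k) i := by
      simp only [Q, u, Pi.smul_apply, smul_eq_mul, Finset.mul_sum]
      exact Finset.sum_congr rfl fun j _ => Finset.sum_congr rfl fun l _ => by ring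
    have h3 : ∑ j, B i j * u k j = ‖d k‖⁻¹ * ∑ j, B i j * d k j := by
      simp only [u, Pi.smul_apply, smul_eq_mul, Finset.mul_sum]
      exact Finset.sum_congr rfl fun j _ => by ring
    rw [h1, h2, h3]
    have := (hs k).ne'
    field_simp
  have hdlim : Tendsto (fun k => ‖d (φ k)‖) atTop (𝓝 0) :=
    (squeeze_zero (fun k => norm_nonneg _) hdk tendsto_one_div_add_atTop_nhds_zero_nat).comp
      hφ.tendsto_atTop
  have hBv : ∀ i, ∑ j, B i j * v j = v i := by
    intro i
    have h1 : Tendsto (fun k => ∑ j, B i j * u (φ k) j + ‖d (φ k)‖ * Q (u (φ k)) i) atTop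
        (𝓝 (∑ j, B i j * v j + 0 * Q v i)) := by
      refine Tendsto.add (tendsto_finsetSum _ fun j _ => (hlimi j).const_mul _) ?_
      refine hdlim.mul ?_
      exact tendsto_finsetSum _ fun j _ => tendsto_finsetSum _ fun l _ =>
        ((hlimi j).mul (hlimi l)).const_mul _
    have h2 := tendsto_nhds_unique (hlimi i) (h1.congr fun k => (hue _ i).symm)
    linarith
  have hev : ∀ᶠ k in atTop, ∀ i, 0 < v i → 0 < u (φ k) i := by
    rw [eventually_all]
    intro i
    by_cases h : 0 < v i
    · filter_upwards [(hlimi i).eventually (lt_mem_nhds h)] with k hk _ using hk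
    · exact Eventually.of_forall fun k h' => absurd h' h
  obtain ⟨K, hK⟩ := hev.exists
  obtain ⟨e, he⟩ : ∃ e, e = d (φ K) := ⟨_, rfl⟩
  have hen : ∀ i, 0 ≤ e i := he ▸ hdn _
  have heq : ∀ i, e i ≤ q i := he ▸ hdq _
  have hee : ∀ i, e i = ∑ j, B i j * e j + Q e i := he ▸ hde _
  have hep : ∀ i, 0 < v i → 0 < e i := by
    intro i hi
    have h1 : 0 < ‖d (φ K)‖⁻¹ * d (φ K) i := hK i hi
    rw [he]
    exact pos_of_mul_pos_right h1 (inv_nonneg.2 (norm_nonneg _))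
  clear_value B Q
  obtain ⟨i1, hi1⟩ := hvne
  obtain ⟨i0, hi0, hmin⟩ := Finset.exists_min_image (Finset.univ.filter fun i => 0 < v i)
    (fun i => e i / v i) ⟨i1, by simpa using hi1⟩
  have hvi0 : 0 < v i0 := by simpa using hi0
  obtain ⟨γ, hγ⟩ : ∃ γ, γ = e i0 / v i0 := ⟨_, rfl⟩
  have hγe : γ * v i0 = e i0 := by rw [hγ]; field_simp
  have hw : ∀ j, 0 ≤ e j - γ * v j := by
    intro j
    rcases (hv0 j).lt_or_eq with h | h
    · have := hmin j (by simpa using h)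
      rw [← hγ, le_div_iff₀ h] at this
      linarith
    · rw [← h]; simpa using hen j
  have hBw : ∀ i, ∑ j, B i j * (e j - γ * v j) = e i - Q e i - γ * v i := by
    intro i
    have : ∑ j, B i j * (e j - γ * v j) = ∑ j, B i j * e j - γ * ∑ j, B i j * v j := by
      rw [Finset.mul_sum, ← Finset.sum_sub_distrib]
      exact Finset.sum_congr rfl fun j _ => by ring
    rw [this, hBv]
    linarith [hee i]
  -- on the zero set of `w`
  have hZ : ∀ i, e i - γ * v i = 0 → Q e i = 0 ∧ ∀ j, e j - γ * v j ≠ 0 → B i j = 0 := by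
    intro i hi
    have hnn : ∀ j, 0 ≤ B i j * (e j - γ * v j) := fun j => mul_nonneg (hB i j) (hw j)
    have h1 : 0 ≤ ∑ j, B i j * (e j - γ * v j) := Finset.sum_nonneg fun j _ => hnn j
    have h2 := hQ0 e hen i
    have h3 := hBw i
    have h4 : ∑ j, B i j * (e j - γ * v j) = 0 := by linarith
    refine ⟨by linarith, fun j hj => ?_⟩
    have := (Finset.sum_eq_zero_iff_of_nonneg fun j _ => hnn j).1 h4 j (Finset.mem_univ j)
    exact (mul_eq_zero.1 this).resolve_right hj
  let y : Fin n → ℝ := fun i => if e i - γ * v i = 0 then q i + (-1) * e i else q i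
  have hy0 : 0 ≤ y := by
    intro i
    show (0 : ℝ) ≤ if _ then _ else _
    split_ifs
    · linarith [heq i]
    · exact (hq i).le
  have hyq : y ≤ q := by
    intro i
    show (if _ then _ else _) ≤ q i
    split_ifs
    · linarith [hen i]
    · exact le_rfl
  have hfy : f y ≤ y := by
    intro i
    by_cases hi : e i - γ * v i = 0
    · obtain ⟨hQi, hBi⟩ := hZ i hi
      have h1 : f y i = f (fun j => q j + (-1) * e j) i := by
        rw [hf, hf]
        congr 1
        · congr 1
          refine Finset.sum_congr rfl fun j _ => ?_
          by_cases hj : e j - γ * v j = 0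
          · simp [y, hj]
          · simp [(hBz i j (hBi j hj)).1]
        · refine Finset.sum_congr rfl fun j _ => Finset.sum_congr rfl fun k _ => ?_
          by_cases hj : e j - γ * v j = 0
          · by_cases hk : e k - γ * v k = 0
            · simp [y, hj, hk]
            · simp [((hBz i k (hBi k hk)).2 j).2]
          · simp [((hBz i j (hBi j hj)).2 k).1]
      have h2 : y i = q i + (-1) * e i := by simp [y, hi]
      rw [h1, hexp, h2]
      have := hee i
      rw [hQi] at this ⊢
      linarith
    · have h1 := hm y q hy0 hyq i
      rw [hfix] at h1
      simpa [y, hi] using h1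
  obtain ⟨z, hz0, hzf, hzy⟩ := exists_fix_le f h0 hm y hy0 hfy
  have h1 := (hleast z hz0 hzf i0).trans (hzy i0)
  have h2 : y i0 = q i0 + (-1) * e i0 := by simp [y, hγe]
  have h3 := hep i0 hvi0
  linarith

theorem stmt13 {n : ℕ} (P : Fin n → MvPolynomial (Fin n) ℝ)
    (hdeg : ∀ i, (P i).totalDegree ≤ 2) (hpos : ∀ i m, 0 ≤ (P i).coeff m)
    (q : Fin n → ℝ) (hq : ∀ i, 0 < q i) (hfix : evalVec P q = q)
    (hleast : ∀ r : Fin n → ℝ, 0 ≤ r → evalVec P r = r → q ≤ r) :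
    ∃ ε > (0 : ℝ), ∀ r : Fin n → ℝ, (∀ i, |r i - q i| ≤ ε) → evalVec P r = r → r = q := by
  choose c b a hc hb ha h using fun i => isQF_eval (P i) (hdeg i) (hpos i)
  exact core (evalVec P) c b a hc hb ha (fun x i => h i x) q hq hfix hleast
end

section
/- Let x = P(x) be an MPS in n variables with least fixed points tracked through value iteration. For k ≥ 0, let Z_k denote the set of coordinates i with P^k(0)_i = 0. Then Z_{k+1} ⊆ Z_k for all k, and if Z_{k+1} = Z_k for some k then Z_{k+l} = Z_k for all l ≥ 0; consequently Z_n = Z_{n+l} for all l ≥ 0, and coordinate i of the least fixed point q* is zero if and only if P^n(0)_i = 0. -/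
open Matrix MvPolynomial

/-- The zero set of the k-th value iterate of an MPS from the zero vector. -/
noncomputable def zeroSet {n : ℕ} (P : Fin n → MvPolynomial (Fin n) ℝ) (k : ℕ) :
    Set (Fin n) := {i | (evalVec P)^[k] 0 i = 0}

lemma eval_mono_aux {n : ℕ} (p : MvPolynomial (Fin n) ℝ) (hp : ∀ m, 0 ≤ p.coeff m)
    {x y : Fin n → ℝ} (hx : 0 ≤ x) (hxy : x ≤ y) :
    MvPolynomial.eval x p ≤ MvPolynomial.eval y p := by
  rw [MvPolynomial.eval_eq', MvPolynomial.eval_eq']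
  refine Finset.sum_le_sum fun m _ => mul_le_mul_of_nonneg_left ?_ (hp m)
  exact Finset.prod_le_prod (fun j _ => pow_nonneg (hx j) _)
    (fun j _ => pow_le_pow_left₀ (hx j) (hxy j) _)

lemma eval_nonneg_aux {n : ℕ} (p : MvPolynomial (Fin n) ℝ) (hp : ∀ m, 0 ≤ p.coeff m)
    {x : Fin n → ℝ} (hx : 0 ≤ x) : 0 ≤ MvPolynomial.eval x p := by
  rw [MvPolynomial.eval_eq']
  exact Finset.sum_nonneg fun m _ =>
    mul_nonneg (hp m) (Finset.prod_nonneg fun j _ => pow_nonneg (hx j) _)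

lemma eval_zero_aux {n : ℕ} (p : MvPolynomial (Fin n) ℝ) (hp : ∀ m, 0 ≤ p.coeff m)
    {x y : Fin n → ℝ} (hx : 0 ≤ x) (hy : 0 ≤ y) (hxy : ∀ j, x j = 0 ↔ y j = 0) :
    MvPolynomial.eval x p = 0 ↔ MvPolynomial.eval y p = 0 := by
  rw [MvPolynomial.eval_eq', MvPolynomial.eval_eq',
    Finset.sum_eq_zero_iff_of_nonneg (fun m _ =>
      mul_nonneg (hp m) (Finset.prod_nonneg fun j _ => pow_nonneg (hx j) _)),
    Finset.sum_eq_zero_iff_of_nonneg (fun m _ =>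
      mul_nonneg (hp m) (Finset.prod_nonneg fun j _ => pow_nonneg (hy j) _))]
  simp only [mul_eq_zero, Finset.prod_eq_zero_iff, pow_eq_zero_iff', hxy]

theorem stmt15 {n : ℕ} (P : Fin n → MvPolynomial (Fin n) ℝ)
    (hpos : ∀ i m, 0 ≤ (P i).coeff m)
    (q : Fin n → ℝ) (hq0 : 0 ≤ q) (hfix : evalVec P q = q)
    (hleast : ∀ r : Fin n → ℝ, 0 ≤ r → evalVec P r = r → q ≤ r) :
    (∀ k, zeroSet P (k + 1) ⊆ zeroSet P k) ∧
    (∀ k, zeroSet P (k + 1) = zeroSet P k → ∀ l, zeroSet P (k + l) = zeroSet P k) ∧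
    (∀ l, zeroSet P (n + l) = zeroSet P n) ∧
    (∀ i, q i = 0 ↔ i ∈ zeroSet P n) := by
  have hnn : ∀ k, 0 ≤ (evalVec P)^[k] 0 := by
    intro k
    induction k with
    | zero => simp
    | succ k ih =>
      rw [Function.iterate_succ_apply']
      exact fun i => eval_nonneg_aux _ (hpos i) ih
  have hstep : ∀ k, (evalVec P)^[k] 0 ≤ (evalVec P)^[k+1] 0 := by
    intro k
    induction k with
    | zero => exact hnn 1
    | succ k ih =>
      rw [Function.iterate_succ_apply' _ (k+1), Function.iterate_succ_apply' _ k] at *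
      exact fun i => eval_mono_aux _ (hpos i) (hnn k) ih
  have hle : ∀ k, (evalVec P)^[k] 0 ≤ q := by
    intro k
    induction k with
    | zero => exact hq0
    | succ k ih =>
      rw [Function.iterate_succ_apply', ← hfix]
      exact fun i => eval_mono_aux _ (hpos i) (hnn k) ih
  have hmono : Monotone (fun k => (evalVec P)^[k] 0) := monotone_nat_of_le_succ hstep
  have h1 : ∀ k, zeroSet P (k + 1) ⊆ zeroSet P k := by
    intro k i hi
    have hi' : (evalVec P)^[k+1] 0 i = 0 := hi
    exact le_antisymm (hi' ▸ hstep k i) (hnn k i)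
  have hnext : ∀ a b, zeroSet P a = zeroSet P b → zeroSet P (a+1) = zeroSet P (b+1) := by
    intro a b h
    ext i
    simp only [zeroSet, Set.mem_setOf_eq]
    rw [Function.iterate_succ_apply', Function.iterate_succ_apply']
    exact eval_zero_aux _ (hpos i) (hnn a) (hnn b) (fun j => Set.ext_iff.mp h j)
  have h2 : ∀ k, zeroSet P (k + 1) = zeroSet P k →
      ∀ l, zeroSet P (k + l) = zeroSet P k := by
    intro k hk l
    induction l with
    | zero => rfl
    | succ l ih => exact (hnext _ _ ih).trans hk
  have h3 : ∀ l, zeroSet P (n + l) = zeroSet P n := by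
    have hex : ∃ k, k ≤ n ∧ zeroSet P (k + 1) = zeroSet P k := by
      by_contra! hcon
      have hc : ∀ k, k ≤ n + 1 → (zeroSet P k).ncard + k ≤ n := by
        intro k
        induction k with
        | zero =>
          intro _
          have := Set.ncard_le_card (zeroSet P 0)
          simpa using this
        | succ k ih =>
          intro hk
          have h4 := Set.ncard_lt_ncard ((h1 k).ssubset_of_ne (hcon k (by omega)))
            (Set.toFinite _)
          have := ih (by omega)
          omega
      have := hc (n+1) le_rfl
      omega
    obtain ⟨k, hk, hkk⟩ := hex
    intro l
    have ha := h2 k hkk (n - k + l)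
    have hb := h2 k hkk (n - k)
    rw [show k + (n - k + l) = n + l by omega] at ha
    rw [show k + (n - k) = n by omega] at hb
    rw [ha, hb]
  refine ⟨h1, h2, h3, fun i => ⟨fun hi => ?_, fun hi => ?_⟩⟩
  · exact le_antisymm (hi ▸ hle n i) (hnn n i)
  · have hbdd : ∀ j, BddAbove (Set.range fun k => (evalVec P)^[k] 0 j) := by
      rintro j
      refine ⟨q j, ?_⟩
      rintro _ ⟨k, rfl⟩
      exact hle k j
    let L : Fin n → ℝ := fun j => ⨆ k, (evalVec P)^[k] 0 j
    have hL : Filter.Tendsto (fun k => (evalVec P)^[k] 0) Filter.atTop (nhds L) :=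
      tendsto_pi_nhds.mpr fun j =>
        tendsto_atTop_ciSup (fun a b hab => hmono hab j) (hbdd j)
    have hcont : Continuous (evalVec P) :=
      continuous_pi fun j => MvPolynomial.continuous_eval (P j)
    have hLfix : evalVec P L = L := by
      have ht := (hcont.tendsto L).comp hL
      have hs := (Filter.tendsto_add_atTop_iff_nat 1).mpr hL
      refine tendsto_nhds_unique ht (hs.congr fun k => ?_)
      rw [Function.iterate_succ_apply']
      rfl
    have hL0 : 0 ≤ L := ge_of_tendsto' hL hnn
    have hqL := hleast L hL0 hLfix i
    have hLi : L i ≤ 0 := by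
      refine ciSup_le fun k => ?_
      have hm : i ∈ zeroSet P (n + k) := by rw [h3 k]; exact hi
      have hm' : (evalVec P)^[n+k] 0 i = 0 := hm
      rw [← hm']
      exact hmono (Nat.le_add_left k n) i
    exact le_antisymm (hqL.trans hLi) (hq0 i)
end
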